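/- arXiv:1507.02722 — 3 statements merged into one kernel-verified Lean document; each statement's English description precedes it below -/
import Mathlib

section
/- Let n ≥ 1, let p be a fixed index in Fin n, and let s : Fin (m+1) → (Fin n → Bool) be a sequence of n-bit vectors such that for every k < m the transition from s k to s (k+1) resets exactly one set bit other than p to 0; that is, there exists an index i ≠ p with s k i = true and s (k+1) = Function.update (s k) i false. Then m ≤ n − 1. (This is the counting core of the claim that if a process p executes n consecutive unsuccessful CAS operations on the object X of the LL/SC/VL implementation, at least one intervening change of X must have been a successful CAS of an SC operation, since every other change only resets a single set bit, each bit can be reset at most once, and p's own bit is never reset.) -/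
/-- Counting core of Claim 1 (`nUnsuccessfulCAS`): if each of `m` consecutive
transitions of an `n`-bit vector resets exactly one set bit other than `p`
from `true` to `false`, then `m ≤ n - 1`. -/
theorem stmt_0 (n m : ℕ) (hn : 1 ≤ n) (p : Fin n)
    (s : Fin (m + 1) → (Fin n → Bool))
    (hstep : ∀ k : Fin m, ∃ i : Fin n, i ≠ p ∧
      s k.castSucc i = true ∧
      s k.succ = Function.update (s k.castSucc) i false) :
    m ≤ n - 1 := by
  have key : ∀ k : Fin (m + 1),
      (k : ℕ) ≤ ((Finset.univ.erase p).filter (fun i => s k i = false)).card := by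
    intro k
    induction k using Fin.induction with
    | zero => simp
    | succ k ih =>
      obtain ⟨i, hip, hi, hs⟩ := hstep k
      have hlt : ((Finset.univ.erase p).filter (fun i => s k.castSucc i = false)).card <
          ((Finset.univ.erase p).filter (fun i => s k.succ i = false)).card := by
        apply Finset.card_lt_card
        rw [Finset.ssubset_iff_of_subset]
        · exact ⟨i, by simp [hip, hs], by simp [hi]⟩
        · intro j hj
          simp only [Finset.mem_filter] at hj ⊢
          refine ⟨hj.1, ?_⟩
          rw [hs, Function.update_apply]
          split_ifs
          · rfl
          · exact hj.2
      simp only [Fin.val_castSucc, Fin.val_succ] at ih ⊢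
      omega
  have h1 := key (Fin.last m)
  have h2 := Finset.card_filter_le (Finset.univ.erase p) (fun i => s (Fin.last m) i = false)
  rw [Finset.card_erase_of_mem (Finset.mem_univ p), Finset.card_univ, Fintype.card_fin] at h2
  simp only [Fin.val_last] at h1
  omega
end

section
/- Let n : ℕ and model a FIFO queue of length n+1 as Q : ℕ → List ℕ with (Q t).length = n + 1 for all t and Q (t+1) = ((Q t) ++ [f t]).tail, where f t is the value enqueued at step t. Suppose additionally that the chosen value is never currently in the queue: for all t, f t ∉ Q t. If t₁ < t₂ and f t₁ = f t₂, then t₂ ≥ t₁ + n + 1; that is, at least n further steps occur strictly between any two steps that choose the same value. (This is the paper's Claim: if two GetSeq operations by the same process return the same sequence number s, then that process completes at least n GetSeq calls between them.) -/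
/-- If a chosen value is never currently in the FIFO queue of length `n + 1`,
then two steps choosing the same value are at least `n + 1` apart. -/
theorem stmt_2 (n : ℕ) (Q : ℕ → List ℕ) (f : ℕ → ℕ)
    (hlen : ∀ t, (Q t).length = n + 1)
    (hstep : ∀ t, Q (t + 1) = ((Q t) ++ [f t]).tail)
    (hfresh : ∀ t, f t ∉ Q t)
    (t₁ t₂ : ℕ) (hlt : t₁ < t₂) (heq : f t₁ = f t₂) :
    t₂ ≥ t₁ + n + 1 := by
  have key : ∀ k, k ≤ n → (Q (t₁ + 1 + k))[n - k]? = some (f t₁) := by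
    intro k
    induction k with
    | zero =>
      intro _
      have h := hlen t₁
      rw [Nat.add_zero, hstep, List.getElem?_tail, Nat.sub_zero,
        List.getElem?_append_right (by omega), h]
      simp
    | succ k ih =>
      intro hk
      have h := hlen (t₁ + 1 + k)
      rw [← Nat.add_assoc, hstep, List.getElem?_tail,
        List.getElem?_append_left (by omega)]
      have e : n - (k + 1) + 1 = n - k := by omega
      rw [e]
      exact ih (by omega)
  by_contra hc
  have h := key (t₂ - (t₁ + 1)) (by omega)
  have e : t₁ + 1 + (t₂ - (t₁ + 1)) = t₂ := by omega
  rw [e, heq] at h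
  exact hfresh t₂ (List.mem_of_getElem? h)
end

section
/- Let n ≥ 1, q : Fin n, and s : ℕ. Consider a round-robin counter c : ℕ → Fin n with c (t+1) = c t + 1 (addition in Fin n, wrapping modulo n), an oracle o : ℕ → Option ℕ, and an announcement table na : ℕ → (Fin n → Option ℕ) updated by na (t+1) = Function.update (na t) (c t) (o t). Let f : ℕ → ℕ be a sequence of chosen values such that the value chosen at step t avoids every entry of the updated table: for all t and all i : Fin n, na (t+1) i ≠ some (f t). Suppose a ≤ b and for every t with a ≤ t ≤ b and c t = q we have o t = some s. Then for every t with a + n ≤ t ≤ b, f t ≠ s. (This is the combinatorial core of the paper's claim that once a pair (p, s) is announced in A[q] and remains announced, process p — which scans one announce-array entry per GetSeq call in round-robin order and blocks any sequence number it reads — does not choose sequence number s again after at most n further GetSeq calls, as long as the announcement persists.) -/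
/-- Combinatorial core of the persistence claim for announced sequence
numbers: a round-robin scan of the announce array blocks the announced
number `s` after at most `n` further steps, as long as the announcement
persists. The round-robin counter `c` satisfies `c (t+1) = c t + 1`, where
addition in `Fin n` wraps modulo `n`. -/
theorem stmt_6 (n : ℕ) (hn : 1 ≤ n) (q : Fin n) (s : ℕ)
    (c : ℕ → Fin n)
    (hc : ∀ t, ((c (t + 1) : ℕ)) = ((c t : ℕ) + 1) % n)
    (o : ℕ → Option ℕ)
    (na : ℕ → (Fin n → Option ℕ))
    (hna : ∀ t, na (t + 1) = Function.update (na t) (c t) (o t))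
    (f : ℕ → ℕ)
    (hf : ∀ t, ∀ i : Fin n, na (t + 1) i ≠ some (f t))
    (a b : ℕ) (hab : a ≤ b)
    (ho : ∀ t, a ≤ t → t ≤ b → c t = q → o t = some s) :
    ∀ t, a + n ≤ t → t ≤ b → f t ≠ s := by
  have h1 : ∀ k, ((c (a + k) : ℕ)) = ((c a : ℕ) + k) % n := by
    intro k
    induction k with
    | zero => simp [Nat.mod_eq_of_lt (c a).isLt]
    | succ k ih =>
      rw [← Nat.add_assoc, hc, ih, Nat.mod_add_mod, Nat.add_assoc]
  obtain ⟨k, hk, hq⟩ : ∃ k, k < n ∧ c (a + k) = q := by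
    have h2 := (c a).isLt
    have h3 := q.isLt
    by_cases h : (c a : ℕ) ≤ q
    · refine ⟨q - c a, by omega, Fin.ext ?_⟩
      rw [h1, Nat.add_sub_cancel' h, Nat.mod_eq_of_lt h3]
    · refine ⟨q + n - c a, by omega, Fin.ext ?_⟩
      rw [h1, Nat.add_sub_cancel' (by omega), Nat.add_mod_right, Nat.mod_eq_of_lt h3]
  have h4 : ∀ t, a + k ≤ t → t ≤ b → na (t + 1) q = some s := by
    intro t ht
    induction t, ht using Nat.le_induction with
    | base =>
      intro hb
      rw [hna, hq, Function.update_self]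
      exact ho _ (by omega) hb hq
    | succ t ht ih =>
      intro hb
      rw [hna]
      by_cases h : c (t + 1) = q
      · rw [h, Function.update_self]
        exact ho _ (by omega) hb h
      · rw [Function.update_of_ne (Ne.symm h)]
        exact ih (by omega)
  intro t ht hb hs
  exact hf t q (by rw [hs]; exact h4 t (by omega) hb)
end
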